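/- Correctness of DMIS (Theorem 2): the DMIS output set S = ⋃_k L(U_k) is a maximal independent set of G; that is, S is independent in G, and every vertex not in S is adjacent in G to some vertex of S (equivalently, S ∪ {v} is not independent for any v ∉ S). -/

import Mathlib

/-- Set of priority-local maxima of `U` in graph `G`. -/
def locMax {V : Type*} (G : SimpleGraph V) (p : V → ℕ) (U : Set V) : Set V :=
  {v | v ∈ U ∧ ∀ u ∈ U, G.Adj v u → p u < p v}

/-- DMIS phase iteration: undecided vertices after `k` phases. -/
def undecided {V : Type*} (G : SimpleGraph V) (p : V → ℕ) : ℕ → Set V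
  | 0 => Set.univ
  | k + 1 =>
      undecided G p k \
        (locMax G p (undecided G p k) ∪
          {w | ∃ v ∈ locMax G p (undecided G p k), G.Adj v w})

theorem undecided_succ_subset {V : Type*} (G : SimpleGraph V) (p : V → ℕ) (k : ℕ) :
    undecided G p (k + 1) ⊆ undecided G p k :=
  Set.sdiff_subset

theorem undecided_antitone {V : Type*} (G : SimpleGraph V) (p : V → ℕ) :
    Antitone (undecided G p) :=
  antitone_nat_of_succ_le (undecided_succ_subset G p)

/-- A nonempty finite set has a local maximum, since distinct vertices have distinct priorities. -/
theorem locMax_nonempty {V : Type*} (G : SimpleGraph V) {p : V → ℕ}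
    (hp : Function.Injective p) {U : Set V} (hU : U.Finite) (hne : U.Nonempty) :
    (locMax G p U).Nonempty := by
  obtain ⟨v, hv, hmax⟩ := Set.exists_max_image U p hU hne
  exact ⟨v, hv, fun u hu hadj =>
    lt_of_le_of_ne (hmax u hu) fun h => hadj.ne (hp h).symm⟩

/-- Each phase decides at least one vertex while undecided vertices remain. -/
theorem exists_undecided_eq_empty {V : Type*} [Finite V] (G : SimpleGraph V) {p : V → ℕ}
    (hp : Function.Injective p) : ∃ k, undecided G p k = ∅ := by
  by_contra! hne
  have hlt (k : ℕ) : (undecided G p (k + 1)).ncard < (undecided G p k).ncard := by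
    obtain ⟨v, hv⟩ := locMax_nonempty G hp (Set.toFinite _) (hne k)
    exact Set.ncard_lt_ncard
      ⟨undecided_succ_subset G p k, fun h => (h hv.1).2 (Or.inl hv)⟩ (Set.toFinite _)
  have hbound (k : ℕ) : (undecided G p k).ncard + k ≤ (undecided G p 0).ncard := by
    induction k with
    | zero => simp
    | succ k ih => have := hlt k; omega
  have := hbound ((undecided G p 0).ncard + 1)
  omega

/-- Every vertex is decided in some phase. -/
theorem exists_mem_undecided_notMem_succ {V : Type*} [Finite V] (G : SimpleGraph V) {p : V → ℕ}
    (hp : Function.Injective p) (v : V) :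
    ∃ k, v ∈ undecided G p k ∧ v ∉ undecided G p (k + 1) := by
  by_contra! h
  obtain ⟨k, hk⟩ := exists_undecided_eq_empty G hp
  have hmem (n : ℕ) : v ∈ undecided G p n := by
    induction n with
    | zero => exact Set.mem_univ v
    | succ n ih => exact h n ih
  simpa [hk] using hmem k

/-- Vertices selected in phases `i ≤ j` are never adjacent. -/
theorem not_adj_of_mem_locMax_undecided {V : Type*} {G : SimpleGraph V} {p : V → ℕ} {i j : ℕ}
    (hij : i ≤ j) {v u : V} (hv : v ∈ locMax G p (undecided G p i))
    (hu : u ∈ locMax G p (undecided G p j)) : ¬ G.Adj v u := by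
  intro hadj
  rcases hij.eq_or_lt with rfl | hlt
  · exact lt_asymm (hv.2 u hu.1 hadj) (hu.2 v hv.1 hadj.symm)
  · exact (undecided_antitone G p (Nat.succ_le_of_lt hlt) hu.1).2 (Or.inr ⟨v, hv, hadj⟩)

theorem dmis_output_maximal_independent {V : Type*} [Fintype V] (G : SimpleGraph V)
    (p : V → ℕ) (hp : Function.Injective p) :
    (∀ v ∈ ⋃ k, locMax G p (undecided G p k),
        ∀ u ∈ ⋃ k, locMax G p (undecided G p k), v ≠ u → ¬ G.Adj v u) ∧
      ∀ v, v ∉ ⋃ k, locMax G p (undecided G p k) →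
        ∃ u ∈ ⋃ k, locMax G p (undecided G p k), G.Adj v u := by
  simp only [Set.mem_iUnion]
  refine ⟨?_, ?_⟩
  · rintro v ⟨i, hv⟩ u ⟨j, hu⟩ - hadj
    rcases le_total i j with hij | hji
    · exact not_adj_of_mem_locMax_undecided hij hv hu hadj
    · exact not_adj_of_mem_locMax_undecided hji hu hv hadj.symm
  · intro v hv
    obtain ⟨k, hk, hk'⟩ := exists_mem_undecided_notMem_succ G hp v
    by_contra! hnot
    refine hk' ⟨hk, ?_⟩
    rintro (hmax | ⟨u, hu, hadj⟩)
    · exact hv ⟨k, hmax⟩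
    · exact hnot u ⟨k, hu⟩ hadj.symm
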